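/- Let A = (A₁, A₂) ∈ ℝ^{k×N} with A₁ ∈ ℝ^{k×(N−r)}, A₂ ∈ ℝ^{k×r}, and r ≤ s, where 2(s−r) < N − r. Suppose A₂ has full column rank, and let P = I − A₂(A₂ᵀA₂)^{−1}A₂ᵀ. If the matrix P·A₁ satisfies the Restricted Isometry Property of order 2(s−r) with constant strictly less than 1/3, then for every pair (z̄₁, z̄₂) with z̄₁ ∈ ℝ^{N−r} an (s−r)-sparse vector and z̄₂ ∈ ℝ^r arbitrary, the optimization problem min ‖z₁‖₁ subject to A₁z₁ + A₂z₂ = A₁z̄₁ + A₂z̄₂ (minimizing over (z₁, z₂)) has (z̄₁, z̄₂) as its unique solution. -/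

import Mathlib

open Matrix BigOperators

/-- The Euclidean (`ℓ₂`) norm of a finitely-indexed real vector. -/
noncomputable def l2 {ι : Type*} [Fintype ι] (v : ι → ℝ) : ℝ := Real.sqrt (∑ i, v i ^ 2)

/-- The `ℓ₁` norm of a finitely-indexed real vector. -/
noncomputable def l1 {ι : Type*} [Fintype ι] (v : ι → ℝ) : ℝ := ∑ i, |v i|

/-- `card' v` is the number of nonzero entries of `v`. -/
noncomputable def card' {ι : Type*} (v : ι → ℝ) : ℕ := Nat.card {i : ι // v i ≠ 0}

/-- `v` is `s`-sparse if it has at most `s` nonzero entries. -/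
def Sparse {ι : Type*} (s : ℕ) (v : ι → ℝ) : Prop := card' v ≤ s

/-- `A` satisfies the Restricted Isometry Property of order `s` with constant `δ`:
`(1 - δ)‖z‖₂² ≤ ‖Az‖₂² ≤ (1 + δ)‖z‖₂²` for every `s`-sparse vector `z`. -/
def RIP {k : ℕ} {ι : Type*} [Fintype ι] (s : ℕ) (δ : ℝ) (A : Matrix (Fin k) ι ℝ) : Prop :=
  ∀ z : ι → ℝ, Sparse s z →
    (1 - δ) * l2 z ^ 2 ≤ l2 (A.mulVec z) ^ 2 ∧ l2 (A.mulVec z) ^ 2 ≤ (1 + δ) * l2 z ^ 2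

open Finset in
lemma aux_top {ι : Type*} [DecidableEq ι] (h : ι → ℝ) (T : Finset ι) (t : ℕ) (ht : t ≤ T.card) :
    ∃ S ⊆ T, S.card = t ∧ ∃ m : ℝ, 0 ≤ m ∧ (∀ i ∈ S, m ≤ |h i|) ∧ ∀ i ∈ T \ S, |h i| ≤ m := by
  induction t with
  | zero =>
    refine ⟨∅, by simp, by simp, ∑ i ∈ T, |h i|, Finset.sum_nonneg fun _ _ => abs_nonneg _,
      by simp, ?_⟩
    intro i hi
    exact Finset.single_le_sum (f := fun i => |h i|) (fun _ _ => abs_nonneg _) (by simpa using hi)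
  | succ t ih =>
    obtain ⟨S, hST, hc, m, hm, h1, h2⟩ := ih (by omega)
    have hne : (T \ S).Nonempty := by
      rw [← Finset.card_pos, Finset.card_sdiff_of_subset hST]; omega
    obtain ⟨a, ha, hmax⟩ := Finset.exists_max_image (T \ S) (fun i => |h i|) hne
    have ha' := Finset.mem_sdiff.1 ha
    refine ⟨insert a S, ?_, ?_, |h a|, abs_nonneg _, ?_, ?_⟩
    · intro i hi
      rcases Finset.mem_insert.1 hi with rfl | hi
      · exact ha'.1
      · exact hST hi
    · rw [Finset.card_insert_of_notMem ha'.2, hc]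
    · intro i hi
      rcases Finset.mem_insert.1 hi with rfl | hi
      · exact le_rfl
      · exact (h2 a ha).trans (h1 i hi)
    · intro i hi
      simp only [Finset.mem_sdiff, Finset.mem_insert, not_or] at hi
      exact hmax i (Finset.mem_sdiff.2 ⟨hi.1, hi.2.2⟩)

lemma aux_l2sq {ι : Type*} [Fintype ι] (v : ι → ℝ) : l2 v ^ 2 = v ⬝ᵥ v := by
  unfold l2
  rw [Real.sq_sqrt (Finset.sum_nonneg fun _ _ => sq_nonneg _)]
  simp [dotProduct, sq]

lemma aux_l2_nonneg {ι : Type*} [Fintype ι] (v : ι → ℝ) : 0 ≤ l2 v := Real.sqrt_nonneg _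

lemma aux_sparse {ι : Type*} [Fintype ι] (v : ι → ℝ) (S : Finset ι) (t : ℕ)
    (hS : S.card ≤ t) (hv : ∀ i ∉ S, v i = 0) : Sparse t v := by
  unfold Sparse card'
  refine le_trans ?_ hS
  classical
  have : Nat.card {i : ι // v i ≠ 0} ≤ Nat.card {i : ι // i ∈ S} := by
    refine Nat.card_le_card_of_injective
      (fun x => ⟨x.1, by by_contra hx; exact x.2 (hv _ hx)⟩) ?_
    intro x y hxy
    simp at hxy
    exact Subtype.ext hxy
  simpa using this

/-- One-sided near-orthogonality. -/
lemma aux_inner {k : ℕ} {ι : Type*} [Fintype ι] [DecidableEq ι] (t : ℕ) (δ : ℝ)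
    (B : Matrix (Fin k) ι ℝ)
    (hB : RIP (2 * t) δ B) (u v : ι → ℝ) (S T : Finset ι) (hS : S.card ≤ t) (hT : T.card ≤ t)
    (hST : Disjoint S T) (hu : ∀ i ∉ S, u i = 0) (hv : ∀ i ∉ T, v i = 0) :
    (B *ᵥ u) ⬝ᵥ (B *ᵥ v) ≤ δ * (l2 u * l2 v) := by
  have key : ∀ a b : ℝ, 2 * (a * b * ((B *ᵥ u) ⬝ᵥ (B *ᵥ v)))
      ≤ δ * (a ^ 2 * l2 u ^ 2 + b ^ 2 * l2 v ^ 2) := by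
    intro a b
    have hsp : ∀ c : ℝ, Sparse (2 * t) (a • u + c • v) := by
      intro c
      refine aux_sparse _ (S ∪ T) _ ((Finset.card_union_le _ _).trans (by omega)) ?_
      intro i hi
      simp only [Finset.mem_union, not_or] at hi
      simp [hu i hi.1, hv i hi.2]
    have huv : u ⬝ᵥ v = 0 := by
      refine Finset.sum_eq_zero fun i _ => ?_
      by_cases hi : i ∈ S
      · rw [hv i (Finset.disjoint_left.1 hST hi), mul_zero]
      · rw [hu i hi, zero_mul]
    have h1 := (hB _ (hsp b)).2
    have h2 := (hB _ (hsp (-b))).1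
    rw [aux_l2sq, aux_l2sq] at h1 h2
    rw [aux_l2sq, aux_l2sq]
    simp only [mulVec_add, mulVec_smul, add_dotProduct, dotProduct_add, smul_dotProduct,
      dotProduct_smul, smul_eq_mul, dotProduct_comm v u, huv,
      dotProduct_comm (B *ᵥ v) (B *ᵥ u)] at h1 h2
    nlinarith
  have hk := key (l2 v) (l2 u)
  rcases (aux_l2_nonneg u).eq_or_lt with h0 | hu0
  · have : u = 0 := by
      have := aux_l2sq u
      rw [← h0] at this
      exact dotProduct_self_eq_zero.1 (by rw [← this]; norm_num)
    simp [this]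
    simp [l2]
  rcases (aux_l2_nonneg v).eq_or_lt with h0 | hv0
  · have : v = 0 := by
      have := aux_l2sq v
      rw [← h0] at this
      exact dotProduct_self_eq_zero.1 (by rw [← this]; norm_num)
    simp [this]
    simp [l2]
  have hp : 0 < l2 u * l2 v := mul_pos hu0 hv0
  refine le_of_mul_le_mul_left ?_ hp
  nlinarith

def auxR {ι : Type*} [DecidableEq ι] (h : ι → ℝ) (S : Finset ι) : ι → ℝ :=
  fun i => if i ∈ S then h i else 0

lemma auxR_l2 {ι : Type*} [Fintype ι] [DecidableEq ι] (h : ι → ℝ) (S : Finset ι) :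
    l2 (auxR h S) = Real.sqrt (∑ i ∈ S, h i ^ 2) := by
  unfold l2 auxR
  simp [Finset.sum_ite_mem, ite_pow]

lemma auxR_add {ι : Type*} [DecidableEq ι] (h : ι → ℝ) (S T : Finset ι) (hST : S ⊆ T) :
    auxR h T = auxR h S + auxR h (T \ S) := by
  ext i
  by_cases h1 : i ∈ S
  · simp [auxR, h1, hST h1]
  · simp [auxR, h1]

lemma auxR_l2_le {ι : Type*} [Fintype ι] [DecidableEq ι] (h : ι → ℝ) (S : Finset ι) (t : ℕ)
    (hS : S.card ≤ t) (M : ℝ) (hM : 0 ≤ M) (hb : ∀ i ∈ S, |h i| ≤ M) :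
    l2 (auxR h S) ≤ Real.sqrt t * M := by
  rw [auxR_l2]
  apply Real.sqrt_le_iff.2 ⟨by positivity, ?_⟩
  rw [mul_pow, Real.sq_sqrt (by positivity)]
  calc ∑ i ∈ S, h i ^ 2 ≤ ∑ i ∈ S, M ^ 2 :=
        Finset.sum_le_sum fun i hi => sq_le_sq' (by linarith [neg_abs_le (h i), hb i hi])
          ((le_abs_self _).trans (hb i hi))
    _ = S.card * M ^ 2 := by simp
    _ ≤ _ := by gcongr

lemma aux_min {ι : Type*} (h : ι → ℝ) (S : Finset ι) (t : ℕ) (ht : 0 < t) (hS : S.card = t)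
    (m : ℝ) (hm : ∀ i ∈ S, m ≤ |h i|) :
    Real.sqrt t * m ≤ (∑ i ∈ S, |h i|) / Real.sqrt t := by
  have : 0 < Real.sqrt t := by positivity
  rw [le_div_iff₀ this]
  have h2 : (t : ℝ) * m ≤ ∑ i ∈ S, |h i| := by
    have := Finset.card_nsmul_le_sum S (fun i => |h i|) m hm
    simpa [hS] using this
  have h3 : Real.sqrt t * Real.sqrt t = t := Real.mul_self_sqrt (by positivity)
  calc Real.sqrt t * m * Real.sqrt t = (Real.sqrt t * Real.sqrt t) * m := by ring
    _ ≤ _ := by rw [h3]; exact h2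

lemma aux_chain {k : ℕ} {ι : Type*} [Fintype ι] [DecidableEq ι] (t : ℕ) (ht : 0 < t) (δ : ℝ)
    (hδ : 0 ≤ δ) (B : Matrix (Fin k) ι ℝ)
    (hB : RIP (2 * t) δ B) (u h : ι → ℝ) (S : Finset ι) (hS : S.card ≤ t)
    (hu : ∀ i ∉ S, u i = 0) (n : ℕ) : ∀ (T : Finset ι), T.card ≤ n → Disjoint S T →
    ∀ M : ℝ, 0 ≤ M → (∀ i ∈ T, |h i| ≤ M) →
    (B *ᵥ u) ⬝ᵥ (B *ᵥ (auxR h T)) ≤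
      δ * l2 u * (Real.sqrt t * M + (∑ i ∈ T, |h i|) / Real.sqrt t) := by
  have hd : 0 ≤ δ * l2 u := mul_nonneg hδ (aux_l2_nonneg u)
  induction n with
  | zero =>
    intro T hT _ M hM _
    have : T = ∅ := by simpa using hT
    subst this
    have : auxR h ∅ = 0 := by ext; simp [auxR]
    rw [this]
    simp
    positivity
  | succ n ih =>
    intro T hT hd' M hM hb
    rcases le_or_gt T.card t with hc | hc
    · have h1 := aux_inner t δ B hB u (auxR h T) S T hS hc hd' hu (by intro i hi; simp [auxR, hi])
      have h2 := auxR_l2_le h T t hc M hM hb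
      have h3 : 0 ≤ (∑ i ∈ T, |h i|) / Real.sqrt t := by positivity
      calc _ ≤ _ := h1
        _ = δ * l2 u * l2 (auxR h T) := by ring
        _ ≤ _ := by gcongr; linarith
    · obtain ⟨T1, hT1, hc1, m, hm, hm1, hm2⟩ := aux_top h T t hc.le
      have h1 := aux_inner t δ B hB u (auxR h T1) S T1 hS hc1.le
        (Finset.disjoint_of_subset_right hT1 hd') hu (by intro i hi; simp [auxR, hi])
      have h2 := auxR_l2_le h T1 t hc1.le M hM (fun i hi => hb i (hT1 hi))
      have h3 := ih (T \ T1) (by rw [Finset.card_sdiff_of_subset hT1]; omega)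
        (Finset.disjoint_of_subset_right Finset.sdiff_subset hd') m hm hm2
      have h4 := aux_min h T1 t ht hc1 m hm1
      rw [auxR_add h T1 T hT1, mulVec_add, dotProduct_add, ← Finset.sum_sdiff hT1, add_div]
      calc _ ≤ _ := add_le_add h1 h3
        _ = δ * l2 u * (l2 (auxR h T1) + (Real.sqrt t * m
              + (∑ i ∈ T \ T1, |h i|) / Real.sqrt t)) := by ring
        _ ≤ _ := by refine mul_le_mul_of_nonneg_left ?_ hd; linarith

lemma aux_nsp {k : ℕ} {ι : Type*} [Fintype ι] [DecidableEq ι] (t : ℕ)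
    (htn : t ≤ Fintype.card ι) (δ : ℝ)
    (hδ : δ < 1 / 3) (B : Matrix (Fin k) ι ℝ)
    (hB : RIP (2 * t) δ B) (h : ι → ℝ) (hh : h ≠ 0) (hBh : B *ᵥ h = 0)
    (S : Finset ι) (hS : S.card ≤ t) : 2 * ∑ i ∈ S, |h i| < ∑ i, |h i| := by
  have hL : 0 < ∑ i, |h i| := by
    obtain ⟨i, hi⟩ := Function.ne_iff.1 hh
    exact Finset.sum_pos' (fun _ _ => abs_nonneg _) ⟨i, Finset.mem_univ _, abs_pos.2 hi⟩
  rcases Nat.eq_zero_or_pos t with h0 | ht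
  · have : S = ∅ := by rw [← Finset.card_eq_zero]; omega
    simpa [this] using hL
  have hδ0 : 0 ≤ δ := by
    obtain ⟨i⟩ : Nonempty ι := Fintype.card_pos_iff.1 (by omega)
    have := hB (Pi.single i 1) (aux_sparse _ {i} _ (by simp; omega) (by
      intro j hj; simp at hj; simp [hj]))
    have h1 : l2 (Pi.single i (1:ℝ)) ^ 2 = 1 := by rw [aux_l2sq]; simp
    rw [h1] at this
    linarith [this.1, this.2]
  obtain ⟨S0, -, hc0, m, hm, hm1, hm2⟩ := aux_top h Finset.univ t (by simpa using htn)
  have hle : ∑ i ∈ S, |h i| ≤ ∑ i ∈ S0, |h i| := by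
    have e1 := Finset.sum_inter_add_sum_sdiff S S0 (fun i => |h i|)
    have e2 := Finset.sum_inter_add_sum_sdiff S0 S (fun i => |h i|)
    rw [Finset.inter_comm] at e2
    have e3 : ∑ i ∈ S \ S0, |h i| ≤ (S \ S0).card • m :=
      Finset.sum_le_card_nsmul _ _ _ fun i hi => hm2 i (by simp at hi ⊢; exact hi.2)
    have e4 : (S0 \ S).card • m ≤ ∑ i ∈ S0 \ S, |h i| :=
      Finset.card_nsmul_le_sum _ _ _ fun i hi => hm1 i (by simp at hi; exact hi.1)
    have e5 : (S \ S0).card ≤ (S0 \ S).card := by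
      have := Finset.card_inter_add_card_sdiff S S0
      have h' := Finset.card_inter_add_card_sdiff S0 S
      rw [Finset.inter_comm] at h'
      omega
    have e6 : (S \ S0).card • m ≤ (S0 \ S).card • m := nsmul_le_nsmul_left hm e5
    linarith
  have hadd := auxR_add h S0 Finset.univ (Finset.subset_univ _)
  have hun : auxR h Finset.univ = h := by ext; simp [auxR]
  rw [hun] at hadd
  have hB0 : B *ᵥ (auxR h (Finset.univ \ S0)) = - (B *ᵥ auxR h S0) := by
    have := hBh
    rw [hadd, mulVec_add] at this
    exact eq_neg_of_add_eq_zero_right this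
  have hch := aux_chain t ht δ hδ0 B hB (-auxR h S0) h S0 hc0.le
    (by intro i hi; simp [auxR, hi]) _ (Finset.univ \ S0) le_rfl Finset.disjoint_sdiff m hm hm2
  have hneg : l2 (-auxR h S0) = l2 (auxR h S0) := by simp [l2]
  rw [hB0, mulVec_neg, hneg, neg_dotProduct, dotProduct_neg, neg_neg, ← aux_l2sq] at hch
  have hlow := (hB (auxR h S0) (aux_sparse _ S0 _ (by omega) (by intro i hi; simp [auxR, hi]))).1
  have h4 := aux_min h S0 t ht hc0 m hm1
  have hsum := Finset.sum_sdiff (f := fun i => |h i|) (Finset.subset_univ S0)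
  have hcs : ∑ i ∈ S0, |h i| ≤ Real.sqrt t * l2 (auxR h S0) := by
    rw [auxR_l2, ← Real.sqrt_mul (by positivity)]
    apply Real.le_sqrt_of_sq_le
    have := sq_sum_le_card_mul_sum_sq (s := S0) (f := fun i => |h i|)
    simpa [hc0] using this
  have hq : 0 < Real.sqrt t := by positivity
  set a := l2 (auxR h S0) with ha
  have ha0 : 0 ≤ a := aux_l2_nonneg _
  rcases ha0.eq_or_lt with h0 | ha1
  · rw [← h0] at hcs
    linarith
  have h5 : (1 - δ) * a ≤ δ * ((∑ i, |h i|) / Real.sqrt t) := by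
    refine le_of_mul_le_mul_left ?_ ha1
    have : δ * a * (Real.sqrt t * m + (∑ i ∈ Finset.univ \ S0, |h i|) / Real.sqrt t)
      ≤ δ * a * ((∑ i, |h i|) / Real.sqrt t) := by
      rw [← hsum, add_div]
      refine mul_le_mul_of_nonneg_left ?_ (mul_nonneg hδ0 ha0)
      linarith
    nlinarith
  rw [← mul_div_assoc, le_div_iff₀ hq] at h5
  have h6 : 0 ≤ ∑ i ∈ S0, |h i| := Finset.sum_nonneg fun _ _ => abs_nonneg _
  nlinarith

/-- Suppose `A₂` has full column rank, `r ≤ s`, `2(s−r) < N − r`, and `P·A₁`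
(with `P = I − A₂(A₂ᵀA₂)⁻¹A₂ᵀ`) satisfies the RIP of order `2(s−r)` with constant `< 1/3`.
Then for every `(s−r)`-sparse `z̄₁` and arbitrary `z̄₂`, the pair `(z̄₁, z̄₂)` is the unique
solution of `min ‖z₁‖₁ s.t. A₁z₁ + A₂z₂ = A₁z̄₁ + A₂z̄₂`: every other feasible pair has a
strictly larger objective value. -/
theorem exact_partially_sparse_recovery_of_partialRIP {k Nr r : ℕ} (s : ℕ) (hrs : r ≤ s)
    (hdim : 2 * (s - r) < Nr)
    (A : Matrix (Fin k) (Fin Nr ⊕ Fin r) ℝ)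
    (hrank : LinearIndependent ℝ (fun j : Fin r => fun i : Fin k => A i (Sum.inr j)))
    (δ : ℝ) (hδ : δ < 1 / 3)
    (hRIP : RIP (2 * (s - r)) δ
      (((1 : Matrix (Fin k) (Fin k) ℝ) -
          A.submatrix id Sum.inr * ((A.submatrix id Sum.inr)ᵀ * A.submatrix id Sum.inr)⁻¹ *
            (A.submatrix id Sum.inr)ᵀ) * A.submatrix id Sum.inl)) :
    ∀ (zbar₁ : Fin Nr → ℝ) (zbar₂ : Fin r → ℝ), Sparse (s - r) zbar₁ →
      ∀ (z₁ : Fin Nr → ℝ) (z₂ : Fin r → ℝ),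
        (A.submatrix id Sum.inl).mulVec z₁ + (A.submatrix id Sum.inr).mulVec z₂ =
          (A.submatrix id Sum.inl).mulVec zbar₁ + (A.submatrix id Sum.inr).mulVec zbar₂ →
        (z₁, z₂) ≠ (zbar₁, zbar₂) → l1 zbar₁ < l1 z₁ := by
  intro zbar₁ zbar₂ hsp z₁ z₂ hfeas hne
  set A₁ := A.submatrix id (Sum.inl : Fin Nr → Fin Nr ⊕ Fin r) with hA₁
  set A₂ := A.submatrix id (Sum.inr : Fin r → Fin Nr ⊕ Fin r) with hA₂
  have hinj : Function.Injective A₂.mulVec := by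
    rw [Matrix.mulVec_injective_iff]
    exact hrank
  have hdet : IsUnit (A₂ᵀ * A₂).det := by
    rw [← Matrix.isUnit_iff_isUnit_det, ← Matrix.mulVec_injective_iff_isUnit]
    intro x y hxy
    have h1 : (A₂ᵀ * A₂) *ᵥ (x - y) = 0 := by
      rw [mulVec_sub]; exact sub_eq_zero.2 hxy
    have h2 : (A₂ *ᵥ (x - y)) ⬝ᵥ (A₂ *ᵥ (x - y)) = 0 := by
      rw [dotProduct_mulVec, ← mulVec_transpose, mulVec_mulVec, h1, zero_dotProduct]
    have h3 : A₂ *ᵥ (x - y) = 0 := dotProduct_self_eq_zero.1 h2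
    rw [mulVec_sub] at h3
    exact hinj (sub_eq_zero.1 h3)
  have hlin : A₁ *ᵥ (z₁ - zbar₁) = A₂ *ᵥ (zbar₂ - z₂) := by
    rw [mulVec_sub, mulVec_sub]
    rw [sub_eq_sub_iff_add_eq_add, hfeas, add_comm]
  have hh : z₁ - zbar₁ ≠ 0 := by
    intro h0
    rw [h0, mulVec_zero] at hlin
    have : zbar₂ - z₂ = 0 := hinj (by simp [← hlin])
    exact hne (Prod.ext (sub_eq_zero.1 h0) (sub_eq_zero.1 this).symm)
  have hPA : ((1 : Matrix (Fin k) (Fin k) ℝ) - A₂ * (A₂ᵀ * A₂)⁻¹ * A₂ᵀ) * A₂ = 0 := by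
    rw [Matrix.sub_mul, Matrix.one_mul, Matrix.mul_assoc, Matrix.mul_assoc,
      Matrix.nonsing_inv_mul _ hdet, Matrix.mul_one, sub_self]
  set S : Finset (Fin Nr) := Finset.univ.filter fun i => zbar₁ i ≠ 0 with hS
  have hScard : S.card ≤ s - r := by
    have : card' zbar₁ = S.card := by
      unfold card'
      rw [Nat.card_eq_fintype_card, Fintype.card_subtype]
    rw [← this]; exact hsp
  have hn := aux_nsp (s - r) (by simp; omega) δ hδ _ hRIP (z₁ - zbar₁) hh
    (by rw [← mulVec_mulVec, hlin, mulVec_mulVec, hPA, zero_mulVec]) S hScard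
  have hpt : ∀ i, |zbar₁ i| + |(z₁ - zbar₁) i|
      - 2 * (if i ∈ S then |(z₁ - zbar₁) i| else 0) ≤ |z₁ i| := by
    intro i
    by_cases hi : i ∈ S
    · have := abs_sub_abs_le_abs_sub (zbar₁ i) (z₁ i)
      rw [abs_sub_comm] at this
      simp only [hi, if_true, Pi.sub_apply]
      linarith
    · have h0 : zbar₁ i = 0 := by simpa [hS] using hi
      simp [hi, h0]
  have hsum := Finset.sum_le_sum fun i (_ : i ∈ Finset.univ) => hpt i
  rw [Finset.sum_sub_distrib, Finset.sum_add_distrib, ← Finset.mul_sum,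
    Finset.sum_ite_mem, Finset.univ_inter] at hsum
  unfold l1
  linarith
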